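/- arXiv:1912.05939 — 2 statements merged into one kernel-verified Lean document; each statement's English description precedes it below -/
import Mathlib

section
/- Let j : ℝ → ℝ be a continuous function. Then the following two conditions are equivalent: (i) limsup_{|s|→+∞} j(s)/s ≤ 0, i.e. the limit superior of j(s)/s as s → +∞ and as s → −∞ are both ≤ 0; (ii) for every γ > 0 there exists a constant c_γ > 0 such that s·j(s) ≤ γ·s² + c_γ for all s ∈ ℝ. -/
/-- Equivalence of the dissipativity condition `limsup_{|s|→∞} j(s)/s ≤ 0`
(stated as: for every `γ > 0` there is `M > 0` with `j s / s ≤ γ` whenever `|s| ≥ M`)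
with the quadratic sign condition: for every `γ > 0` there is `c > 0` with
`s * j s ≤ γ * s ^ 2 + c` for all real `s`. -/
theorem stmt_0 (j : ℝ → ℝ) (hj : Continuous j) :
    (∀ γ : ℝ, 0 < γ → ∃ M : ℝ, 0 < M ∧ ∀ s : ℝ, M ≤ |s| → j s / s ≤ γ) ↔
      (∀ γ : ℝ, 0 < γ → ∃ c : ℝ, 0 < c ∧ ∀ s : ℝ, s * j s ≤ γ * s ^ 2 + c) := by
  have quotient_le_iff {s : ℝ} (hs : s ≠ 0) (γ : ℝ) : j s / s ≤ γ ↔ s * j s ≤ γ * s ^ 2 := by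
    rw [← div_le_iff₀ (by positivity : 0 < s ^ 2), show s * j s / s ^ 2 = j s / s by field_simp]
  constructor
  · intro h γ hγ
    obtain ⟨M, hM, hjM⟩ := h γ hγ
    obtain ⟨C, hC⟩ := (isCompact_Icc (a := -M) (b := M)).bddAbove_image
      (continuous_id.mul hj).continuousOn
    refine ⟨|C| + 1, by positivity, fun s => ?_⟩
    rcases le_total M |s| with hs | hs
    · have hs₀ : s ≠ 0 := abs_pos.mp (hM.trans_le hs)
      have := (quotient_le_iff hs₀ γ).mp (hjM s hs)
      linarith [abs_nonneg C]
    · have hle : s * j s ≤ C := hC ⟨s, abs_le.mp hs, rfl⟩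
      have : 0 ≤ γ * s ^ 2 := by positivity
      linarith [le_abs_self C]
  · intro h γ hγ
    obtain ⟨c, hc, hjc⟩ := h (γ / 2) (half_pos hγ)
    have hM : 0 < √(2 * c / γ) := by positivity
    refine ⟨√(2 * c / γ), hM, fun s hs => ?_⟩
    refine (quotient_le_iff (abs_pos.mp (hM.trans_le hs)) γ).mpr ?_
    have hsq : 2 * c / γ ≤ s ^ 2 := by
      rw [← sq_abs]
      exact (Real.sqrt_le_left (abs_nonneg s)).mp hs
    rw [div_le_iff₀ hγ] at hsq
    linarith [hjc s]
end

section
/- Let X and H be real Banach spaces, R : H → X a bounded linear operator, x₀ ∈ X, and G : X → H a map with G(x₀) = 0 satisfying ‖G(x) − G(y)‖_H ≤ L · max(‖x − x₀‖_X, ‖y − x₀‖_X) · ‖x − y‖_X for all x, y ∈ X, for some constant L > 0. Then for every δ with 0 < δ < 1/(L·‖R‖), the point x₀ is the unique solution of the equation x = x₀ − R(G(x)) in the closed ball { x ∈ X : ‖x − x₀‖_X ≤ δ }. In particular, x₀ is an isolated solution of this equation. -/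
/-- Let `R : H → X` be a bounded linear operator between real Banach spaces, `x₀ ∈ X`,
and `G : X → H` with `G x₀ = 0` satisfying the quadratic Lipschitz estimate
`‖G x − G y‖ ≤ L · max (‖x − x₀‖, ‖y − x₀‖) · ‖x − y‖` for some `L > 0`
(we assume `L · ‖R‖ > 0`).  Then for every `δ` with `0 < δ < 1/(L·‖R‖)`, the point `x₀`
is the unique solution of `x = x₀ − R (G x)` in the closed ball of radius `δ` around `x₀`;
in particular `x₀` is an isolated solution of this equation. -/
theorem stmt_4 {X H : Type*} [NormedAddCommGroup X] [NormedSpace ℝ X] [CompleteSpace X]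
    [NormedAddCommGroup H] [NormedSpace ℝ H] [CompleteSpace H]
    (R : H →L[ℝ] X) (x₀ : X) (G : X → H) (L : ℝ) (hL : 0 < L)
    (hG₀ : G x₀ = 0)
    (hG : ∀ x y : X, ‖G x - G y‖ ≤ L * max ‖x - x₀‖ ‖y - x₀‖ * ‖x - y‖)
    (hLR : 0 < L * ‖R‖) :
    ∀ δ : ℝ, 0 < δ → δ < 1 / (L * ‖R‖) →
      (x₀ = x₀ - R (G x₀)) ∧
        ∀ x : X, ‖x - x₀‖ ≤ δ → x = x₀ - R (G x) → x = x₀ := by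
  intro δ _ hδ
  refine ⟨by simp [hG₀], fun x hx hfix => ?_⟩
  have hδ' : δ * (L * ‖R‖) < 1 := (lt_div_iff₀ hLR).mp hδ
  have hGx : ‖G x‖ ≤ L * ‖x - x₀‖ * ‖x - x₀‖ := by
    simpa [hG₀] using hG x x₀
  have hnorm : ‖x - x₀‖ = ‖R (G x)‖ := by
    have h : x - x₀ = -R (G x) := by
      rw [sub_eq_iff_eq_add, neg_add_eq_sub]
      exact hfix
    rw [h, norm_neg]
  have hcontr : ‖x - x₀‖ ≤ δ * (L * ‖R‖) * ‖x - x₀‖ :=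
    calc ‖x - x₀‖ = ‖R (G x)‖ := hnorm
      _ ≤ ‖R‖ * ‖G x‖ := R.le_opNorm _
      _ ≤ ‖R‖ * (L * ‖x - x₀‖ * ‖x - x₀‖) := by gcongr
      _ ≤ ‖R‖ * (L * δ * ‖x - x₀‖) := by gcongr
      _ = δ * (L * ‖R‖) * ‖x - x₀‖ := by ring
  by_contra hne
  have hpos : 0 < ‖x - x₀‖ := norm_pos_iff.mpr (sub_ne_zero.mpr hne)
  exact absurd hcontr (not_le.mpr (mul_lt_of_lt_one_left hpos hδ'))
end
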